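/- Let S be a d-dimensional simplex in ℝ^d with centroid at the origin such that λ₁(S)⁻¹ is a positive integer and #(S ∩ ℤ^d) = C(d + λ₁(S)⁻¹(d+1), d). Then, with n = λ₁(S)⁻¹(d+1), the set of barycentric coordinate vectors of the lattice points of S equals R = (1/n)·{a ∈ ℤ^{d+1} : a_i ≥ 0 for all i, Σ_{i=1}^{d+1} a_i = n}; i.e., β_S(S ∩ ℤ^d) = R. -/

import Mathlib

open MeasureTheory Set Pointwise

/-- The set of integer lattice points of `ℝ^d`. -/
def latticePts (d : ℕ) : Set (Fin d → ℝ) := {x | ∀ i, ∃ z : ℤ, x i = (z : ℝ)}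

theorem aux_card (d n : ℕ) :
    Set.ncard {b : Fin (d+1) → ℕ | ∑ i, b i = n} = (d + n).choose d := by
  rw [← Nat.card_coe_set_eq]
  change Nat.card {b : Fin (d+1) → ℕ // ∑ i, b i = n} = _
  rw [Nat.card_congr (β := Sym (Fin (d+1)) n) (Sym.equivNatSumOfFintype (Fin (d+1)) n).symm]
  rw [Nat.card_eq_fintype_card, Sym.card_sym_eq_choose, Fintype.card_fin]
  rw [show d + 1 + n - 1 = d + n by omega, Nat.choose_symm_add]

theorem aux_comb {X : Type*} (d n : ℕ) (P : Set X) (a : X → Fin (d+1) → ℝ)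
    (ha : ∀ x ∈ P, ∀ i, 0 ≤ a x i) (hs : ∀ x ∈ P, ∑ i, a x i = n)
    (hsep : ∀ x ∈ P, ∀ y ∈ P, x ≠ y → ∃ i, a x i - a y i ≤ -1)
    (hc : P.ncard = (d + n).choose d) :
    (∀ x ∈ P, ∃ b : Fin (d+1) → ℕ, ∑ i, b i = n ∧ a x = fun i => (b i : ℝ)) ∧
    ∀ b : Fin (d+1) → ℕ, ∑ i, b i = n → ∃ x ∈ P, a x = fun i => (b i : ℝ) := by
  classical
  have hfl : ∀ x ∈ P, ∑ i : Fin d, ⌊a x i.castSucc⌋₊ ≤ n := by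
    intro x hx
    have h1 := hs x hx
    rw [Fin.sum_univ_castSucc] at h1
    have h2 : ∑ i : Fin d, (⌊a x i.castSucc⌋₊ : ℝ) ≤ ∑ i : Fin d, a x i.castSucc :=
      Finset.sum_le_sum fun i _ => Nat.floor_le (ha x hx _)
    have h3 := ha x hx (Fin.last d)
    have : ((∑ i : Fin d, ⌊a x i.castSucc⌋₊ : ℕ) : ℝ) ≤ n := by push_cast; linarith
    exact_mod_cast this
  let F : X → Fin (d+1) → ℕ := fun x =>
    Fin.snoc (α := fun _ => ℕ) (fun i : Fin d => ⌊a x i.castSucc⌋₊) (n - ∑ i : Fin d, ⌊a x i.castSucc⌋₊)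
  have hF : ∀ x (i : Fin d), F x i.castSucc = ⌊a x i.castSucc⌋₊ := fun x i => by
    simp [F]
  have hFs : ∀ x ∈ P, ∑ i, F x i = n := by
    intro x hx
    rw [Fin.sum_univ_castSucc]
    have := hfl x hx
    simp only [F, Fin.snoc_castSucc, Fin.snoc_last]
    omega
  have hinj : ∀ x y, x ∈ P → y ∈ P → F x = F y → x = y := by
    intro x y hx hy h
    by_contra hne
    have key : ∀ x ∈ P, ∀ y ∈ P, F x = F y → ∀ i : Fin d, -1 < a x i.castSucc - a y i.castSucc := by
      intro x hx y hy h i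
      have h1 := congrFun h i.castSucc
      rw [hF, hF] at h1
      have h2 := Nat.floor_le (ha x hx i.castSucc)
      have h3 := Nat.lt_floor_add_one (a y i.castSucc)
      rw [h1] at h2
      linarith
    have last : ∀ x ∈ P, ∀ y ∈ P, F x = F y → x ≠ y → a x (Fin.last d) - a y (Fin.last d) ≤ -1 := by
      intro x hx y hy h hne
      obtain ⟨i, hi⟩ := hsep x hx y hy hne
      induction i using Fin.lastCases with
      | last => exact hi
      | cast i => have := key x hx y hy h i; linarith
    have h1 := last x hx y hy h hne
    have h2 := last y hy x hx h.symm (Ne.symm hne)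
    linarith
  have hfin : {b : Fin (d+1) → ℕ | ∑ i, b i = n}.Finite := by
    apply Set.finite_of_ncard_pos
    rw [aux_card]
    exact Nat.choose_pos (by omega)
  have hsurj : ∀ b : Fin (d+1) → ℕ, ∑ i, b i = n → ∃ x ∈ P, b = F x := by
    intro b hb
    obtain ⟨x, hx, h⟩ := Set.surj_on_of_inj_on_of_ncard_le (s := P) (t := {b : Fin (d+1) → ℕ | ∑ i, b i = n})
      (fun x _ => F x) (fun x hx => hFs x hx) (fun x y hx hy h => hinj x y hx hy h)
      (by rw [aux_card, hc]) hfin b hb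
    exact ⟨x, hx, h⟩
  have main : ∀ s, ∀ x ∈ P, F x (Fin.last d) = s → a x = fun i => (F x i : ℝ) := by
    intro s
    induction s with
    | zero =>
      intro x hx h0
      have h1 := hFs x hx
      have h2 := hs x hx
      rw [Fin.sum_univ_castSucc] at h1 h2
      have hle : ∀ i ∈ (Finset.univ : Finset (Fin d)), (F x i.castSucc : ℝ) ≤ a x i.castSucc :=
        fun i _ => by rw [hF]; exact Nat.floor_le (ha x hx _)
      have h3 := ha x hx (Fin.last d)
      have h4 := Finset.sum_le_sum hle
      have h5 : (∑ i : Fin d, (F x i.castSucc : ℝ)) = n := by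
        rw [h0] at h1; exact_mod_cast h1
      have h6 : (∑ i : Fin d, (F x i.castSucc : ℝ)) = ∑ i : Fin d, a x i.castSucc := by linarith
      have h7 := (Finset.sum_eq_sum_iff_of_le hle).1 h6
      ext i
      induction i using Fin.lastCases with
      | last => rw [h0]; push_cast; linarith
      | cast i => exact (h7 i (Finset.mem_univ _)).symm
    | succ s ih =>
      intro x hx h0
      have h1 := hFs x hx
      have h2 := hs x hx
      rw [Fin.sum_univ_castSucc] at h1 h2
      have hle : ∀ i ∈ (Finset.univ : Finset (Fin d)), (F x i.castSucc : ℝ) ≤ a x i.castSucc :=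
        fun i _ => by rw [hF]; exact Nat.floor_le (ha x hx _)
      have hlt : ∀ i : Fin d, a x i.castSucc < F x i.castSucc + 1 :=
        fun i => by rw [hF]; exact Nat.lt_floor_add_one _
      have h1' : (∑ i : Fin d, (F x i.castSucc : ℝ)) + (s + 1) = n := by
        rw [h0] at h1; exact_mod_cast h1
      have h4 := Finset.sum_le_sum hle
      have hsum : (∑ i : Fin d, (F x i.castSucc : ℝ)) = ∑ i : Fin d, a x i.castSucc := by
        rcases Nat.eq_zero_or_pos d with hd | hd
        · subst hd; simp
        · let i₀ : Fin d := ⟨0, hd⟩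
          let b : Fin (d+1) → ℕ := Fin.snoc (α := fun _ => ℕ)
            (fun i : Fin d => F x i.castSucc + if i = i₀ then 1 else 0) s
          have hb1 : ∀ i : Fin d, b i.castSucc = F x i.castSucc + if i = i₀ then 1 else 0 := by
            intro i; simp [b]
          have hb2 : b (Fin.last d) = s := by simp [b]
          have hb : ∑ i, b i = n := by
            rw [Fin.sum_univ_castSucc, hb2]
            simp only [hb1, Finset.sum_add_distrib, Finset.sum_ite_eq', Finset.mem_univ, if_true]
            omega
          obtain ⟨y, hy, hby⟩ := hsurj b hb
          have hay := ih y hy (by rw [← hby, hb2])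
          rw [← hby] at hay
          have hay1 : ∀ i : Fin d, a y i.castSucc = F x i.castSucc + if i = i₀ then 1 else 0 := by
            intro i; rw [hay]; simp only [hb1]; push_cast; rfl
          have hay2 : a y (Fin.last d) = s := by rw [hay]; simp only [hb2]
          have hne : y ≠ x := by
            rintro rfl
            have := hay1 i₀
            have := hlt i₀
            simp at *
            linarith
          obtain ⟨i, hi⟩ := hsep y hy x hx hne
          induction i using Fin.lastCases with
          | last => rw [hay2] at hi; linarith
          | cast i =>
            rw [hay1] at hi
            have := hlt i
            split_ifs at hi <;> linarith
      have h7 := (Finset.sum_eq_sum_iff_of_le hle).1 hsum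
      ext i
      induction i using Fin.lastCases with
      | last => rw [h0]; push_cast; linarith
      | cast i => exact (h7 i (Finset.mem_univ _)).symm
  refine ⟨fun x hx => ⟨F x, hFs x hx, main _ x hx rfl⟩, fun b hb => ?_⟩
  obtain ⟨x, hx, rfl⟩ := hsurj b hb
  exact ⟨x, hx, main _ x hx rfl⟩

theorem aux_centroid (d : ℕ) (b : AffineBasis (Fin (d+1)) ℝ (Fin d → ℝ))
    (hcent : (⨍ x in convexHull ℝ (Set.range b), x) = (0 : Fin d → ℝ)) (p q : Fin (d+1)) :
    b.coord p 0 = b.coord q 0 := by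
  classical
  set S := convexHull ℝ (Set.range b) with hSdef
  let σ := Equiv.swap p q
  have hSc : S = {x | ∀ i, 0 ≤ b.coord i x} := b.convexHull_eq_nonneg_coord
  have hcomp : IsCompact S := (Set.finite_range b).isCompact_convexHull ℝ
  have hmeas : MeasurableSet S := hcomp.measurableSet
  have hfin : volume S ≠ ⊤ := hcomp.measure_lt_top.ne
  have hpos : volume S ≠ 0 := by
    have h : (interior S).Nonempty :=
      interior_convexHull_nonempty_iff_affineSpan_eq_top.2 b.tot
    exact (Measure.measure_pos_of_nonempty_interior _ h).ne'
  have hfact : Fact (volume S < ⊤) := ⟨hcomp.measure_lt_top⟩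
  have hint : ∫ x in S, x = (0 : Fin d → ℝ) := by
    have := measure_smul_average (volume.restrict S) (fun x : Fin d → ℝ => x)
    rw [hcent, smul_zero] at this
    exact this.symm
  let L : (Fin d → ℝ) →ₗ[ℝ] (Fin d → ℝ) := ∑ i, ((b.coord i).linear).smulRight (b (σ i))
  let A : (Fin d → ℝ) → (Fin d → ℝ) := fun x => ∑ i, b.coord i x • b (σ i)
  have hdec : ∀ i x, b.coord i x = b.coord i 0 + (b.coord i).linear x := by
    intro i x
    have := congrFun (b.coord i).decomp x
    rw [this]; simp [add_comm]
  have hA : ∀ x, A x = A 0 + L x := by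
    intro x
    simp only [A, L, LinearMap.sum_apply, LinearMap.smulRight_apply, ← Finset.sum_add_distrib,
      ← add_smul, ← hdec]
  have hσσ : ∀ i, σ (σ i) = i := fun i => Equiv.swap_apply_self p q i
  have hAc : ∀ x j, b.coord j (A x) = b.coord (σ j) x := by
    intro x j
    have h1 : A x = ∑ i, b.coord (σ i) x • b i := by
      simp only [A]
      rw [← Equiv.sum_comp σ]
      simp only [hσσ]
    have h2 : ∑ i, b.coord (σ i) x = 1 := by
      rw [Equiv.sum_comp σ (fun i => b.coord i x)]; exact b.sum_coord_apply_eq_one x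
    have h3 := b.ind.eq_of_sum_eq_sum (s := Finset.univ) (w₁ := fun i => b.coord i (A x))
      (w₂ := fun i => b.coord (σ i) x) (by rw [h2, b.sum_coord_apply_eq_one])
      (by rw [b.linear_combination_coord_eq_self, h1])
    exact h3 j (Finset.mem_univ _)
  have hAA : ∀ x, A (A x) = x := by
    intro x
    apply b.ext_elem
    intro i
    rw [hAc, hAc, hσσ]
  have hLL : L.comp L = LinearMap.id := by
    refine LinearMap.ext fun x => ?_
    have h1 := hAA x
    have h0 := hAA 0
    rw [hA (A x), hA x, map_add] at h1
    rw [hA (A 0)] at h0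
    change L (L x) = x
    rw [← add_assoc, h0, zero_add] at h1
    exact h1
  have hdet : |LinearMap.det L| = 1 := by
    have h := congrArg LinearMap.det hLL
    rw [LinearMap.det_comp, LinearMap.det_id] at h
    rcases mul_self_eq_one_iff.1 h with h | h <;> rw [h] <;> simp
  have himg : A '' S = S := by
    have hsub : ∀ x ∈ S, A x ∈ S := by
      intro x hx
      rw [hSc] at hx ⊢
      intro i; rw [hAc]; exact hx _
    ext x
    constructor
    · rintro ⟨y, hy, rfl⟩; exact hsub y hy
    · intro hx; exact ⟨A x, hsub x hx, hAA x⟩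
  have hder : ∀ x ∈ S, HasFDerivWithinAt A (LinearMap.toContinuousLinearMap L) S x := by
    intro x _
    have : A = fun x => A 0 + LinearMap.toContinuousLinearMap L x := by
      funext x; exact hA x
    rw [this]
    exact ((LinearMap.toContinuousLinearMap L).hasFDerivAt.const_add _).hasFDerivWithinAt
  have hcv := integral_image_eq_integral_abs_det_fderiv_smul volume hmeas hder
    (fun x _ y _ h => by rw [← hAA x, ← hAA y, h]) (fun x => x)
  have hi : IntegrableOn (fun x : Fin d → ℝ => x) S :=
    continuous_id.continuousOn.integrableOn_compact hcomp
  have hA0 : A 0 = 0 := by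
    rw [himg, hint] at hcv
    simp only [LinearMap.det_toContinuousLinearMap, hdet, one_smul] at hcv
    rw [integral_congr_ae (Filter.Eventually.of_forall hA)] at hcv
    have h3 : IntegrableOn (fun x => L x) S := (LinearMap.toContinuousLinearMap L).integrable_comp hi
    have h2 := (LinearMap.toContinuousLinearMap L).integral_comp_comm hi
    change ∫ x in S, L x = L (∫ x in S, x) at h2
    rw [integral_add (integrable_const _) h3,
      h2, hint, map_zero, add_zero, setIntegral_const] at hcv
    rcases smul_eq_zero.1 hcv.symm with h | h
    · exact absurd h (ENNReal.toReal_pos hpos hfin).ne'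
    · exact h
  have := hAc 0 q
  rw [hA0] at this
  simpa [σ] using this.symm

/-- **Barycentric coordinates of the lattice points in the equality case.** Let
`S ⊆ ℝ^d` be a `d`-simplex with centroid at the origin whose first successive minimum
satisfies `λ₁(S)⁻¹ = k` for a positive integer `k`, and suppose
`#(S ∩ ℤ^d) = C(d + k(d+1), d)`. Then, with `n = k(d+1)`, the set of barycentric
coordinate vectors of the lattice points of `S` is exactly
`R = (1/n)·{a ∈ ℤ^{d+1} : a ≥ 0, ∑ aᵢ = n}`. -/
theorem barycentric_coordinates_of_lattice_points_equality_case
    (d : ℕ) (v : Fin (d + 1) → (Fin d → ℝ))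
    (hv : AffineIndependent ℝ v) (S : Set (Fin d → ℝ))
    (hS : S = convexHull ℝ (Set.range v))
    (hcent : (⨍ x in S, x) = (0 : Fin d → ℝ))
    (l1 : ℝ)
    (hl1 : IsLeast {l : ℝ | 0 < l ∧ ∃ z : Fin d → ℤ,
      (fun i => (z i : ℝ)) ≠ 0 ∧ (fun i => (z i : ℝ)) ∈ l • S} l1)
    (k : ℕ) (hk : 0 < k) (hlk : l1⁻¹ = (k : ℝ))
    (β : (Fin d → ℝ) → (Fin (d + 1) → ℝ))
    (hβ : ∀ x : Fin d → ℝ, (∑ i, β x i = 1) ∧ (∑ i, β x i • v i = x))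
    (hcard : Set.ncard (S ∩ latticePts d) = (d + k * (d + 1)).choose d) :
    β '' (S ∩ latticePts d) =
      {y : Fin (d + 1) → ℝ | ∃ a : Fin (d + 1) → ℤ,
        (∀ i, 0 ≤ a i) ∧ (∑ i, a i = ((k * (d + 1) : ℕ) : ℤ)) ∧
        y = fun i => (a i : ℝ) / ((k * (d + 1) : ℕ) : ℝ)} := by
  have htop : affineSpan ℝ (Set.range v) = ⊤ := by
    rw [hv.affineSpan_eq_top_iff_card_eq_finrank_add_one]; simp
  let b : AffineBasis (Fin (d+1)) ℝ (Fin d → ℝ) := ⟨v, hv, htop⟩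
  have hbv : ∀ i, b i = v i := fun i => rfl
  have hSb : S = convexHull ℝ (Set.range b) := hS
  have hSc : S = {x | ∀ i, 0 ≤ b.coord i x} := hSb.trans b.convexHull_eq_nonneg_coord
  have hβc : ∀ x i, β x i = b.coord i x := by
    intro x i
    exact hv.eq_of_sum_eq_sum (s := Finset.univ) (w₁ := β x) (w₂ := fun i => b.coord i x)
      (by rw [(hβ x).1, b.sum_coord_apply_eq_one])
      (by rw [(hβ x).2]; exact (b.linear_combination_coord_eq_self x).symm) i (Finset.mem_univ _)
  rw [hSb] at hcent
  have hd1 : (0 : ℝ) < d + 1 := by positivity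
  have hk0 : (0 : ℝ) < k := by exact_mod_cast hk
  have h0 : ∀ i, b.coord i 0 = 1 / ((d : ℝ) + 1) := by
    intro i
    have h1 := b.sum_coord_apply_eq_one 0
    rw [Finset.sum_congr rfl (fun j _ => aux_centroid d b hcent j i)] at h1
    simp only [Finset.sum_const, Finset.card_univ, Fintype.card_fin, nsmul_eq_mul] at h1
    push_cast at h1
    field_simp
    linarith
  have hdec : ∀ i x, b.coord i x = 1 / ((d : ℝ) + 1) + (b.coord i).linear x := by
    intro i x
    rw [← h0 i, congrFun (b.coord i).decomp x]; simp [add_comm]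
  have hl1' : l1 = 1 / (k : ℝ) := by rw [← hlk]; simp
  -- nonzero lattice vectors have a very negative coordinate
  have key : ∀ z : Fin d → ℤ, (fun i => (z i : ℝ)) ≠ 0 →
      ∃ i, ((k * (d + 1) : ℕ) : ℝ) * (b.coord i).linear (fun i => (z i : ℝ)) ≤ -1 := by
    intro z hz
    by_contra! hcon
    set x : Fin d → ℝ := fun i => (z i : ℝ) with hx
    obtain ⟨m, hm⟩ := Finite.exists_min (fun i => (b.coord i).linear x)
    have hm1 := hcon m
    push_cast at hm1
    obtain ⟨l, hl, hl'⟩ := exists_between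
      (show max 0 (-((d : ℝ) + 1) * (b.coord m).linear x) < 1 / (k : ℝ) by
        apply max_lt (by positivity)
        rw [lt_div_iff₀ hk0]
        linarith)
    have hl0 : 0 < l := lt_of_le_of_lt (le_max_left _ _) hl
    have hl2 := lt_of_le_of_lt (le_max_right _ _) hl
    have hmem : l ∈ {l : ℝ | 0 < l ∧ ∃ z : Fin d → ℤ,
      (fun i => (z i : ℝ)) ≠ 0 ∧ (fun i => (z i : ℝ)) ∈ l • S} := by
      refine ⟨hl0, z, hz, ?_⟩
      rw [Set.mem_smul_set_iff_inv_smul_mem₀ hl0.ne', hSc]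
      intro i
      rw [hdec, map_smul, smul_eq_mul]
      have h3 := hm i
      have h4 : -((d : ℝ) + 1) * (b.coord i).linear x ≤ l := by nlinarith
      have h5 : 1 / ((d : ℝ) + 1) + l⁻¹ * (b.coord i).linear x
          = (l + (d + 1) * (b.coord i).linear x) / ((d + 1) * l) := by field_simp
      change 0 ≤ 1 / ((d : ℝ) + 1) + l⁻¹ * (b.coord i).linear x
      rw [h5]
      apply div_nonneg _ (by positivity)
      linarith
    have := hl1.2 hmem
    rw [hl1'] at this
    linarith
  have hn0 : (0 : ℝ) < ((k * (d + 1) : ℕ) : ℝ) := by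
    have : 0 < k * (d + 1) := by positivity
    exact_mod_cast this
  generalize k * (d + 1) = n at *
  obtain ⟨H1, H2⟩ := aux_comb d n (S ∩ latticePts d) (fun x i => (n : ℝ) * b.coord i x)
    (by
      rintro x ⟨hx, -⟩ i
      rw [hSc] at hx
      exact mul_nonneg hn0.le (hx i))
    (by
      intro x _
      rw [← Finset.mul_sum, b.sum_coord_apply_eq_one, mul_one])
    (by
      rintro x ⟨-, hx⟩ y ⟨-, hy⟩ hne
      choose zx hzx using hx
      choose zy hzy using hy
      have hxy : (fun i => ((zx i - zy i : ℤ) : ℝ)) = x - y := by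
        funext i; simp [hzx, hzy]
      obtain ⟨i, hi⟩ := key (fun i => zx i - zy i) (by rw [hxy]; exact sub_ne_zero.2 hne)
      rw [hxy, map_sub] at hi
      refine ⟨i, ?_⟩
      rw [hdec i x, hdec i y]
      linarith)
    hcard
  ext y
  constructor
  · rintro ⟨x, hx, rfl⟩
    obtain ⟨a, ha, hax⟩ := H1 x hx
    refine ⟨fun i => a i, fun i => by positivity, by dsimp only; exact_mod_cast ha, ?_⟩
    funext i
    have : (n : ℝ) * b.coord i x = a i := congrFun hax i
    rw [hβc, eq_div_iff hn0.ne', mul_comm, this]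
    simp
  · rintro ⟨a, ha, hs, rfl⟩
    lift a to Fin (d + 1) → ℕ using ha
    obtain ⟨x, hx, hax⟩ := H2 a (by dsimp only at hs; exact_mod_cast hs)
    refine ⟨x, hx, ?_⟩
    funext i
    have : (n : ℝ) * b.coord i x = a i := congrFun hax i
    rw [hβc, eq_div_iff hn0.ne', mul_comm, this]
    simp
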